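/- (Compactness.) There exists ε₀ > 0 with the following property: if C > 0, ε_k ∈ (0,ε₀) is a sequence with ε_k → 0, and μ_k are Borel probability measures on ℝ^d with E_{ε_k}(μ_k) ≤ C for all k, then there exist a subsequence (k_j), translation vectors y_j ∈ ℝ^d, and a Borel probability measure μ on ℝ^d such that the translated measures μ_{k_j}(· + y_j) (i.e., the pushforwards of μ_{k_j} under x ↦ x − y_j) converge to μ weakly-* as j → ∞. -/

import Mathlib

open MeasureTheory Filter
open scoped ENNReal Topology NNReal

noncomputable section

/-- Power-law interaction kernel `K(x) = |x|^q/q - |x|^p/p` (real-valued). -/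
noncomputable def Kfun (d : ℕ) (p q : ℝ) (x : EuclideanSpace ℝ (Fin d)) : ℝ :=
  ‖x‖ ^ q / q - ‖x‖ ^ p / p

/-- Power-law interaction kernel, valued in `[0,∞]` (note `K 0 = ∞` when `p < 0 < q`). -/
noncomputable def KE (d : ℕ) (p q : ℝ) (x : EuclideanSpace ℝ (Fin d)) : ℝ≥0∞ :=
  (‖x‖₊ : ℝ≥0∞) ^ q / ENNReal.ofReal q + (‖x‖₊ : ℝ≥0∞) ^ p / ENNReal.ofReal (-p)

/-- Repulsive part `K^r(x) = -|x|^p/p` of the power-law kernel, valued in `[0,∞]`. -/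
noncomputable def KrE (d : ℕ) (p : ℝ) (x : EuclideanSpace ℝ (Fin d)) : ℝ≥0∞ :=
  (‖x‖₊ : ℝ≥0∞) ^ p / ENNReal.ofReal (-p)

/-- Rescaled mollifier `φ_ε(x) = ε^{-d} φ(x/ε)`. -/
noncomputable def scaled (d : ℕ) (φ : EuclideanSpace ℝ (Fin d) → ℝ) (ε : ℝ)
    (x : EuclideanSpace ℝ (Fin d)) : ℝ :=
  (ε ^ d)⁻¹ * φ (ε⁻¹ • x)

/-- Mollifier hypotheses (M1)–(M3). -/
def IsMollifier (d : ℕ) (φ : EuclideanSpace ℝ (Fin d) → ℝ) : Prop :=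
  ContDiff ℝ (⊤ : ℕ∞) φ ∧ (∀ x y, ‖x‖ = ‖y‖ → φ x = φ y) ∧ (∀ x, 0 ≤ φ x) ∧
    (∫ x, φ x) = 1 ∧
    ∃ C : ℝ, 0 < C ∧ ∃ l : ℝ, max (2 * (d : ℝ) + 1) 4 ≤ l ∧
      ∀ x : EuclideanSpace ℝ (Fin d), x ≠ 0 → φ x ≤ C * ‖x‖ ^ (-l)

/-- Regularized kernel `K_ε = φ_ε * K * φ_ε` (real-valued). -/
noncomputable def Kreg (d : ℕ) (p q : ℝ) (φ : EuclideanSpace ℝ (Fin d) → ℝ) (ε : ℝ)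
    (x : EuclideanSpace ℝ (Fin d)) : ℝ :=
  ∫ y, ∫ z, scaled d φ ε y * Kfun d p q (x - y - z) * scaled d φ ε z

/-- Double mollification `g * K * g` of a `[0,∞]`-valued kernel by a nonnegative function. -/
noncomputable def convE (d : ℕ) (g : EuclideanSpace ℝ (Fin d) → ℝ)
    (K : EuclideanSpace ℝ (Fin d) → ℝ≥0∞) (x : EuclideanSpace ℝ (Fin d)) : ℝ≥0∞ :=
  ∫⁻ y, ∫⁻ z, ENNReal.ofReal (g y) * K (x - y - z) * ENNReal.ofReal (g z)

/-- Interaction energy `E(μ) = ∬ K(x-y) dμ(x) dμ(y)` for a `[0,∞]`-valued kernel. -/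
noncomputable def energyE (d : ℕ) (K : EuclideanSpace ℝ (Fin d) → ℝ≥0∞)
    (μ : Measure (EuclideanSpace ℝ (Fin d))) : ℝ≥0∞ :=
  ∫⁻ x, ∫⁻ y, K (x - y) ∂μ ∂μ

/-- Regularized interaction energy `E_ε(μ) = ∬ K_ε(x-y) dμ(x) dμ(y)`. -/
noncomputable def energyReg (d : ℕ) (p q : ℝ) (φ : EuclideanSpace ℝ (Fin d) → ℝ) (ε : ℝ)
    (μ : Measure (EuclideanSpace ℝ (Fin d))) : ℝ≥0∞ :=
  energyE d (fun x => ENNReal.ofReal (Kreg d p q φ ε x)) μ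

/-- Real-valued interaction energy. -/
noncomputable def energyReal (d : ℕ) (p q : ℝ) (μ : Measure (EuclideanSpace ℝ (Fin d))) : ℝ :=
  ∫ x, ∫ y, Kfun d p q (x - y) ∂μ ∂μ

/-- Borel probability measure with finite second moment. -/
def IsP2 (d : ℕ) (μ : Measure (EuclideanSpace ℝ (Fin d))) : Prop :=
  IsProbabilityMeasure μ ∧ (∫⁻ x, (‖x‖₊ : ℝ≥0∞) ^ 2 ∂μ) < ⊤

/-- The heat kernel `ψ_ε(x) = (4πε)^{-d/2} e^{-|x|²/(4ε)}`. -/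
noncomputable def heat (d : ℕ) (ε : ℝ) (x : EuclideanSpace ℝ (Fin d)) : ℝ :=
  (4 * Real.pi * ε) ^ (-(d : ℝ) / 2) * Real.exp (-‖x‖ ^ 2 / (4 * ε))

/-- Weak-* convergence of a sequence of measures: convergence of integrals of all bounded
continuous functions. -/
def WeakStarTendsto (d : ℕ) (μ : ℕ → Measure (EuclideanSpace ℝ (Fin d)))
    (ν : Measure (EuclideanSpace ℝ (Fin d))) : Prop :=
  ∀ f : EuclideanSpace ℝ (Fin d) → ℝ, Continuous f → (∃ M : ℝ, ∀ x, |f x| ≤ M) →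
    Tendsto (fun k => ∫ x, f x ∂(μ k)) atTop (𝓝 (∫ x, f x ∂ν))

/-- `μ` is absolutely continuous (w.r.t. Lebesgue) with density bounded by `R`. -/
def HasBddDensity (d : ℕ) (μ : Measure (EuclideanSpace ℝ (Fin d))) (R : ℝ) : Prop :=
  ∃ ρ : EuclideanSpace ℝ (Fin d) → ℝ≥0∞, Measurable ρ ∧ μ = volume.withDensity ρ ∧
    ∀ᵐ x ∂(volume : Measure (EuclideanSpace ℝ (Fin d))), ρ x ≤ ENNReal.ofReal R

/-- Explicit gradient `∇K(x) = x|x|^{q-2} - x|x|^{p-2}` of the power-law kernel. -/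
noncomputable def gradK (d : ℕ) (p q : ℝ) (x : EuclideanSpace ℝ (Fin d)) :
    EuclideanSpace ℝ (Fin d) :=
  (‖x‖ ^ (q - 2)) • x - (‖x‖ ^ (p - 2)) • x

/-- The log-Lipschitz modulus of convexity `ω`. -/
noncomputable def omegaMod (x : ℝ) : ℝ :=
  if x ≤ Real.exp (-1 - Real.sqrt 2) then x * |Real.log x|
  else Real.sqrt (x ^ 2 + 2 * (1 + Real.sqrt 2) * Real.exp (-1 - Real.sqrt 2) * x)

/-- Support of a measure: points all of whose neighborhoods have positive measure. -/
def msupport (d : ℕ) (μ : Measure (EuclideanSpace ℝ (Fin d))) :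
    Set (EuclideanSpace ℝ (Fin d)) :=
  {x | ∀ r : ℝ, 0 < r → 0 < μ (Metric.ball x r)}

/-- The measure `μ * ψ_δ` obtained by mollifying `μ` with the heat kernel at scale `δ`. -/
noncomputable def heatMollified (d : ℕ) (μ : Measure (EuclideanSpace ℝ (Fin d))) (δ : ℝ) :
    Measure (EuclideanSpace ℝ (Fin d)) :=
  volume.withDensity fun x => ENNReal.ofReal (∫ y, heat d δ (x - y) ∂μ)

/-- Local integrability of the repulsive singularity. -/
lemma aux_sing (d : ℕ) (hd : 3 ≤ d) (p : ℝ) (hp1 : 2 - (d : ℝ) ≤ p) :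
    Integrable ((Metric.ball (0 : EuclideanSpace ℝ (Fin d)) 1).indicator (fun x => ‖x‖ ^ p)) := by
  have : Nontrivial (EuclideanSpace ℝ (Fin d)) := by
    apply Module.nontrivial_of_finrank_pos (R := ℝ)
    simp; omega
  have h := integrable_fun_norm_addHaar (E := EuclideanSpace ℝ (Fin d)) (volume)
    (f := (Set.Iio (1:ℝ)).indicator (fun r => r ^ p))
  have e : ((Metric.ball (0 : EuclideanSpace ℝ (Fin d)) 1).indicator (fun x => ‖x‖ ^ p))
      = fun x => (Set.Iio (1:ℝ)).indicator (fun r => r ^ p) ‖x‖ := by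
    funext x
    by_cases hx : ‖x‖ < 1 <;> simp [Set.indicator, hx]
  rw [e, h]
  have h1 : IntegrableOn (fun r : ℝ => r ^ ((d:ℝ) - 1 + p)) (Set.Ioo 0 1) := by
    rw [intervalIntegral.integrableOn_Ioo_rpow_iff one_pos]
    linarith
  rw [← integrable_indicator_iff measurableSet_Ioo] at h1
  refine (h1.integrableOn (s := Set.Ioi 0)).congr_fun ?_ measurableSet_Ioi
  intro r hr
  have hr : 0 < r := hr
  by_cases h2 : r < 1
  · simp only [Set.indicator, Set.mem_Ioo, hr, h2, Set.mem_Iio, finrank_euclideanSpace,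
      Fintype.card_fin, smul_eq_mul, and_self, if_true]
    rw [Real.rpow_add hr, ← Real.rpow_natCast, Nat.cast_sub (by omega)]
    simp
  · simp [Set.indicator, h2]

/-- Weighted integrability and boundedness of the mollifier. -/
lemma aux_moll (d : ℕ) (hd : 3 ≤ d)
    (φ : EuclideanSpace ℝ (Fin d) → ℝ) (hφ : IsMollifier d φ) :
    Integrable (fun x => (1 + ‖x‖ ^ 2) * φ x) ∧ ∃ M : ℝ, ∀ x, φ x ≤ M := by
  obtain ⟨hs, -, h0, -, C, hC, l, hl, hb⟩ := hφ
  have hcont : Continuous φ := hs.continuous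
  obtain ⟨M, hM⟩ := (isCompact_closedBall (0 : EuclideanSpace ℝ (Fin d)) 1).exists_bound_of_continuousOn
    hcont.continuousOn
  have hM1 : ∀ x, ‖x‖ ≤ 1 → φ x ≤ M := fun x hx =>
    (le_abs_self _).trans (hM x (by simpa using hx))
  have hM0 : 0 ≤ M := (h0 0).trans (hM1 0 (by simp))
  have hl1 : 2 * (d:ℝ) + 1 ≤ l := (le_max_left _ _).trans hl
  have hd' : (3:ℝ) ≤ d := by exact_mod_cast hd
  have hb1 : ∀ x : EuclideanSpace ℝ (Fin d), 1 ≤ ‖x‖ → φ x ≤ C * ‖x‖ ^ (-((d:ℝ) + 3)) := by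
    intro x hx
    have hx0 : x ≠ 0 := by
      rintro rfl
      simp at hx
      linarith
    refine (hb x hx0).trans ?_
    have : ‖x‖ ^ (-l) ≤ ‖x‖ ^ (-((d:ℝ) + 3)) :=
      Real.rpow_le_rpow_of_exponent_le hx (by linarith)
    gcongr
  refine ⟨?_, max M C, ?_⟩
  · have hI := integrable_one_add_norm (E := EuclideanSpace ℝ (Fin d)) (μ := volume)
      (r := (d:ℝ) + 1) (by simp)
    refine (hI.const_mul ((2 * M + 2 * C) * 2 ^ ((d:ℝ) + 1))).mono'
      (by fun_prop) (Eventually.of_forall fun x => ?_)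
    rw [Real.norm_of_nonneg (mul_nonneg (by positivity) (h0 x))]
    have key : ∀ a : ℝ, 0 < a → 1 + ‖x‖ ≤ 2 * a →
        a ^ (-((d:ℝ)+1)) ≤ 2 ^ ((d:ℝ) + 1) * (1 + ‖x‖) ^ (-((d:ℝ) + 1)) := by
      intro a ha hle
      have h1 : (2 * a) ^ (-((d:ℝ)+1)) ≤ (1 + ‖x‖) ^ (-((d:ℝ) + 1)) :=
        Real.rpow_le_rpow_of_nonpos (by positivity) hle (by linarith)
      have h2 : a ^ (-((d:ℝ)+1)) = 2 ^ ((d:ℝ) + 1) * (2 * a) ^ (-((d:ℝ)+1)) := by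
        rw [Real.mul_rpow (by norm_num) ha.le, ← mul_assoc, ← Real.rpow_add (by norm_num)]
        simp
      rw [h2]
      gcongr
    rw [mul_assoc]
    rcases le_total ‖x‖ 1 with hx | hx
    · have k1 := key 1 one_pos (by linarith)
      rw [Real.one_rpow] at k1
      calc (1 + ‖x‖ ^ 2) * φ x ≤ 2 * M := by
            have := hM1 x hx
            have h3 : ‖x‖ ^ 2 ≤ 1 := pow_le_one₀ (norm_nonneg _) hx
            exact mul_le_mul (by linarith) this (h0 x) (by norm_num)
        _ ≤ (2 * M + 2 * C) * 1 := by linarith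
        _ ≤ _ := by gcongr
    · have k1 := key ‖x‖ (by linarith) (by linarith)
      have hx0 : 0 < ‖x‖ := by linarith
      calc (1 + ‖x‖ ^ 2) * φ x ≤ (2 * ‖x‖ ^ 2) * (C * ‖x‖ ^ (-((d:ℝ) + 3))) := by
            have h3 : 1 ≤ ‖x‖ ^ 2 := one_le_pow₀ hx
            exact mul_le_mul (by linarith) (hb1 x hx) (h0 x) (by positivity)
        _ = (2 * C) * ‖x‖ ^ (-((d:ℝ) + 1)) := by
            have : ‖x‖ ^ (-((d:ℝ) + 1)) = ‖x‖ ^ 2 * ‖x‖ ^ (-((d:ℝ) + 3)) := by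
              rw [← Real.rpow_natCast, ← Real.rpow_add hx0]
              congr 1
              push_cast
              ring
            rw [this]; ring
        _ ≤ (2 * M + 2 * C) * ‖x‖ ^ (-((d:ℝ) + 1)) := by
            gcongr
            linarith
        _ ≤ _ := by gcongr
  · intro x
    rcases le_total ‖x‖ 1 with hx | hx
    · exact (hM1 x hx).trans (le_max_left _ _)
    · refine (hb1 x hx).trans (le_trans ?_ (le_max_right _ _))
      have : ‖x‖ ^ (-((d:ℝ) + 3)) ≤ 1 := Real.rpow_le_one_of_one_le_of_nonpos hx (by linarith)
      nlinarith

/-- Integrability of the integrand defining the regularized kernel. -/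
lemma aux_prod (d : ℕ) (hd : 3 ≤ d) (p q : ℝ) (hp1 : 2 - (d : ℝ) ≤ p) (hp2 : p < 0)
    (hq1 : 0 < q) (hq2 : q ≤ 2) (g : EuclideanSpace ℝ (Fin d) → ℝ) (hgc : Continuous g)
    (hg0 : ∀ x, 0 ≤ g x) (M : ℝ) (hM : ∀ x, g x ≤ M)
    (hgi : Integrable (fun x => (1 + ‖x‖ ^ 2) * g x)) (hg : Integrable g)
    (x : EuclideanSpace ℝ (Fin d)) :
    Integrable (fun w : EuclideanSpace ℝ (Fin d) × EuclideanSpace ℝ (Fin d) =>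
      g w.1 * Kfun d p q (x - w.1 - w.2) * g w.2) (volume.prod volume) := by
  set h : EuclideanSpace ℝ (Fin d) → ℝ :=
    (Metric.ball (0 : EuclideanSpace ℝ (Fin d)) 1).indicator (fun x => ‖x‖ ^ p) with hh
  have hhi : Integrable h := aux_sing d hd p hp1
  have hhm : Measurable h := by
    refine Measurable.indicator (by fun_prop) measurableSet_ball
  have hh0 : ∀ w, 0 ≤ h w := fun w => Set.indicator_nonneg (fun y _ => by positivity) w
  have hgm : Measurable g := hgc.measurable
  have hM0 : 0 ≤ M := (hg0 0).trans (hM 0)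
  have I1 : Integrable (fun w : EuclideanSpace ℝ (Fin d) × EuclideanSpace ℝ (Fin d) =>
      ((1 + ‖w.1‖ ^ 2) * g w.1) * ((1 + ‖w.2‖ ^ 2) * g w.2)) (volume.prod volume) :=
    hgi.mul_prod hgi
  have I2 : Integrable (fun w : EuclideanSpace ℝ (Fin d) × EuclideanSpace ℝ (Fin d) =>
      g w.1 * h (x - w.1 - w.2)) (volume.prod volume) := by
    rw [integrable_prod_iff (by fun_prop)]
    constructor
    · refine Eventually.of_forall fun y => ?_
      exact (hhi.comp_sub_left (x - y)).const_mul (g y)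
    · have : (fun y => ∫ z, ‖g y * h (x - y - z)‖) = fun y => g y * ∫ z, h z := by
        funext y
        rw [← integral_sub_left_eq_self h volume (x - y), ← integral_const_mul]
        congr 1
        funext z
        rw [Real.norm_of_nonneg (mul_nonneg (hg0 _) (hh0 _))]
      simp only [this]
      exact hg.mul_const _
  have hKm : Measurable (Kfun d p q) := by unfold Kfun; fun_prop
  refine ((I1.const_mul ((1 + 3 * (1 + ‖x‖ ^ 2)) / q + 1 / (-p))).add
    (I2.const_mul (M / (-p)))).mono' (by fun_prop) (Eventually.of_forall ?_)
  rintro ⟨y, z⟩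
  simp only [Pi.add_apply]
  set w := x - y - z with hw
  have hK0 : Kfun d p q w = ‖w‖ ^ q / q + ‖w‖ ^ p / (-p) := by
    unfold Kfun; rw [div_neg]; ring
  have hnp : 0 < -p := by linarith
  have hKn : 0 ≤ Kfun d p q w := by rw [hK0]; positivity
  rw [Real.norm_of_nonneg (mul_nonneg (mul_nonneg (hg0 _) hKn) (hg0 _))]
  have hq : ‖w‖ ^ q ≤ 1 + ‖w‖ ^ 2 := by
    rcases le_total ‖w‖ 1 with h1 | h1
    · have := Real.rpow_le_one (norm_nonneg w) h1 hq1.le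
      nlinarith [sq_nonneg ‖w‖]
    · have := Real.rpow_le_rpow_of_exponent_le h1 hq2
      rw [Real.rpow_two] at this
      linarith
  have hpb : ‖w‖ ^ p ≤ 1 + h w := by
    rcases lt_or_ge ‖w‖ 1 with h1 | h1
    · have : h w = ‖w‖ ^ p := by simp [hh, Set.indicator, h1]
      linarith
    · have := Real.rpow_le_one_of_one_le_of_nonpos h1 hp2.le
      linarith [hh0 w]
  have hwn : ‖w‖ ≤ ‖x‖ + ‖y‖ + ‖z‖ := by
    have := norm_sub_le (x - y) z
    have := norm_sub_le x y
    linarith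
  set P := (1 + ‖y‖ ^ 2) * (1 + ‖z‖ ^ 2) with hP
  have hP1 : 1 ≤ P := by rw [hP]; nlinarith [sq_nonneg ‖y‖, sq_nonneg ‖z‖, mul_nonneg (sq_nonneg ‖y‖) (sq_nonneg ‖z‖)]
  have hP2 : ‖y‖ ^ 2 + ‖z‖ ^ 2 ≤ P := by rw [hP]; nlinarith [mul_nonneg (sq_nonneg ‖y‖) (sq_nonneg ‖z‖)]
  have hw2 : ‖w‖ ^ 2 ≤ 3 * (1 + ‖x‖ ^ 2) * P := by
    have e1 : ‖w‖ ^ 2 ≤ (‖x‖ + ‖y‖ + ‖z‖) ^ 2 := by gcongr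
    have e2 : (‖x‖ + ‖y‖ + ‖z‖) ^ 2 ≤ 3 * (‖x‖ ^ 2 + (‖y‖ ^ 2 + ‖z‖ ^ 2)) := by
      nlinarith [sq_nonneg (‖x‖ - ‖y‖), sq_nonneg (‖x‖ - ‖z‖), sq_nonneg (‖y‖ - ‖z‖)]
    have e3 : ‖x‖ ^ 2 ≤ ‖x‖ ^ 2 * P := le_mul_of_one_le_right (sq_nonneg _) hP1
    nlinarith
  have hKb : Kfun d p q w ≤ ((1 + 3 * (1 + ‖x‖ ^ 2)) / q + 1 / (-p)) * P + h w / (-p) := by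
    rw [hK0]
    have a1 : ‖w‖ ^ q / q ≤ (1 + 3 * (1 + ‖x‖ ^ 2)) * P / q := by
      gcongr; nlinarith
    have a2 : ‖w‖ ^ p / (-p) ≤ (P + h w) / (-p) := by
      gcongr; linarith
    calc _ ≤ _ := add_le_add a1 a2
      _ = _ := by ring
  have hgg : 0 ≤ g y * g z := mul_nonneg (hg0 _) (hg0 _)
  calc g y * Kfun d p q w * g z = (g y * g z) * Kfun d p q w := by ring
    _ ≤ (g y * g z) * (((1 + 3 * (1 + ‖x‖ ^ 2)) / q + 1 / (-p)) * P + h w / (-p)) := by gcongr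
    _ = ((1 + 3 * (1 + ‖x‖ ^ 2)) / q + 1 / (-p)) * ((1 + ‖y‖ ^ 2) * g y * ((1 + ‖z‖ ^ 2) * g z))
        + g z * (g y * h w / (-p)) := by rw [hP]; ring
    _ ≤ ((1 + 3 * (1 + ‖x‖ ^ 2)) / q + 1 / (-p)) * ((1 + ‖y‖ ^ 2) * g y * ((1 + ‖z‖ ^ 2) * g z))
        + M * (g y * h w / (-p)) := by
          have := hM z
          have : 0 ≤ g y * h w / (-p) := div_nonneg (mul_nonneg (hg0 _) (hh0 _)) hnp.le
          gcongr
    _ = _ := by ring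

/-- Lower bound on the doubly mollified kernel. -/
lemma aux_lower (d : ℕ) (p q : ℝ) (hp2 : p < 0)
    (hq1 : 0 < q) (g : EuclideanSpace ℝ (Fin d) → ℝ)
    (hg0 : ∀ x, 0 ≤ g x) (hg : Integrable g)
    (x : EuclideanSpace ℝ (Fin d))
    (hI : Integrable (fun w : EuclideanSpace ℝ (Fin d) × EuclideanSpace ℝ (Fin d) =>
      g w.1 * Kfun d p q (x - w.1 - w.2) * g w.2) (volume.prod volume))
    (R : ℝ) (hR : 1 ≤ R) (hx : 2 * R ≤ ‖x‖)
    (hm : 1 / 2 ≤ ∫ y, (Metric.closedBall (0 : EuclideanSpace ℝ (Fin d)) (1/2)).indicator g y) :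
    R ^ q / q / 4 ≤ ∫ y, ∫ z, g y * Kfun d p q (x - y - z) * g z := by
  rw [← integral_prod _ hI]
  set G := (Metric.closedBall (0 : EuclideanSpace ℝ (Fin d)) (1/2)).indicator g with hG
  have hGi : Integrable G := hg.indicator measurableSet_closedBall
  have hnp : 0 < -p := by linarith
  have hc : 0 ≤ R ^ q / q := by positivity
  have h1 : ∫ w : EuclideanSpace ℝ (Fin d) × EuclideanSpace ℝ (Fin d),
      (R ^ q / q) * (G w.1 * G w.2) ∂(volume.prod volume) ≤
      ∫ w : EuclideanSpace ℝ (Fin d) × EuclideanSpace ℝ (Fin d),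
        g w.1 * Kfun d p q (x - w.1 - w.2) * g w.2 ∂(volume.prod volume) := by
    refine integral_mono ((hGi.mul_prod hGi).const_mul _) hI ?_
    rintro ⟨y, z⟩
    have hK0 : ‖x - y - z‖ ^ q / q ≤ Kfun d p q (x - y - z) := by
      have : 0 ≤ ‖x - y - z‖ ^ p / (-p) := by positivity
      rw [div_neg] at this
      unfold Kfun; linarith
    have hKn : 0 ≤ Kfun d p q (x - y - z) := le_trans (by positivity) hK0
    have hrhs : 0 ≤ g y * Kfun d p q (x - y - z) * g z :=
      mul_nonneg (mul_nonneg (hg0 _) hKn) (hg0 _)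
    show (R ^ q / q) * (G y * G z) ≤ g y * Kfun d p q (x - y - z) * g z
    by_cases hy : ‖y‖ ≤ 1/2
    swap
    · have : G y = 0 := Set.indicator_of_notMem (by simpa using hy) _
      simpa [this] using hrhs
    by_cases hz : ‖z‖ ≤ 1/2
    swap
    · have : G z = 0 := Set.indicator_of_notMem (by simpa using hz) _
      simpa [this] using hrhs
    have e1 : G y = g y := Set.indicator_of_mem (by simpa using hy) _
    have e2 : G z = g z := Set.indicator_of_mem (by simpa using hz) _
    have hw : R ≤ ‖x - y - z‖ := by
      have := norm_sub_norm_le (x - y) z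
      have := norm_sub_norm_le x y
      linarith
    have : R ^ q / q ≤ Kfun d p q (x - y - z) := by
      refine le_trans ?_ hK0
      gcongr
    rw [e1, e2]
    have hgg : 0 ≤ g y * g z := mul_nonneg (hg0 _) (hg0 _)
    nlinarith [mul_le_mul_of_nonneg_left this hgg]
  refine le_trans ?_ h1
  rw [integral_const_mul, integral_prod_mul]
  nlinarith [mul_le_mul hm hm (by norm_num) (by linarith : 0 ≤ ∫ y, G y)]

/-- Uniform lower bound on the regularized kernel. -/
lemma aux_kreg (d : ℕ) (hd : 3 ≤ d) (p q : ℝ) (hp1 : 2 - (d : ℝ) ≤ p) (hp2 : p < 0)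
    (hq1 : 0 < q) (hq2 : q ≤ 2)
    (φ : EuclideanSpace ℝ (Fin d) → ℝ) (hφ : IsMollifier d φ) :
    ∃ ε₀ : ℝ, 0 < ε₀ ∧ ∀ ε ∈ Set.Ioo 0 ε₀, ∀ R : ℝ, 1 ≤ R → ∀ x : EuclideanSpace ℝ (Fin d),
      2 * R ≤ ‖x‖ → R ^ q / q / 4 ≤ Kreg d p q φ ε x := by
  obtain ⟨hwi, M, hM⟩ := aux_moll d hd φ hφ
  obtain ⟨hs, -, h0, hone, -⟩ := hφ
  have hcont : Continuous φ := hs.continuous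
  have hi : Integrable φ := by
    by_contra h
    rw [integral_undef h] at hone
    norm_num at hone
  have hlim : Tendsto (fun n : ℕ => ∫ x in Metric.closedBall (0 : EuclideanSpace ℝ (Fin d)) n, φ x)
      atTop (𝓝 (∫ x in ⋃ n : ℕ, Metric.closedBall (0 : EuclideanSpace ℝ (Fin d)) n, φ x)) :=
    tendsto_setIntegral_of_monotone (fun n => measurableSet_closedBall)
      (fun a b hab => Metric.closedBall_subset_closedBall (by exact_mod_cast hab)) hi.integrableOn
  rw [Metric.iUnion_closedBall_nat, setIntegral_univ, hone] at hlim
  obtain ⟨n, hn⟩ := (hlim.eventually (lt_mem_nhds (by norm_num : (1/2:ℝ) < 1))).exists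
  refine ⟨1 / (2 * (n + 1)), by positivity, ?_⟩
  rintro ε ⟨hε0, hε1⟩ R hR x hx
  have hεd : 0 < ε ^ d := by positivity
  have hg0 : ∀ y, 0 ≤ scaled d φ ε y := fun y => mul_nonneg (by positivity) (h0 _)
  have hgc : Continuous (scaled d φ ε) := by unfold scaled; fun_prop
  have hg : Integrable (scaled d φ ε) :=
    (hi.comp_smul (inv_ne_zero hε0.ne')).const_mul _
  have hgM : ∀ y, scaled d φ ε y ≤ (ε ^ d)⁻¹ * M := fun y => by
    unfold scaled
    have := hM (ε⁻¹ • y)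
    gcongr
  have hgi : Integrable (fun y => (1 + ‖y‖ ^ 2) * scaled d φ ε y) := by
    have h1 := ((hwi.comp_smul (inv_ne_zero hε0.ne')).const_mul ((1 + ε ^ 2) * (ε ^ d)⁻¹))
    refine h1.mono' (by fun_prop) (Eventually.of_forall fun y => ?_)
    rw [Real.norm_of_nonneg (mul_nonneg (by positivity) (hg0 y))]
    unfold scaled
    have : 1 + ‖y‖ ^ 2 ≤ (1 + ε ^ 2) * (1 + ‖ε⁻¹ • y‖ ^ 2) := by
      rw [norm_smul, Real.norm_of_nonneg (by positivity), mul_pow]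
      have : ε ^ 2 * ((ε⁻¹) ^ 2 * ‖y‖ ^ 2) = ‖y‖ ^ 2 := by field_simp
      have : 0 ≤ (ε⁻¹) ^ 2 * ‖y‖ ^ 2 := by positivity
      nlinarith [sq_nonneg ε]
    have h2 := h0 (ε⁻¹ • y)
    calc _ ≤ ((1 + ε ^ 2) * (1 + ‖ε⁻¹ • y‖ ^ 2)) * ((ε ^ d)⁻¹ * φ (ε⁻¹ • y)) := by gcongr
      _ = _ := by ring
  refine aux_lower d p q hp2 hq1 (scaled d φ ε) hg0 hg x
    (aux_prod d hd p q hp1 hp2 hq1 hq2 _ hgc hg0 _ hgM hgi hg x) R hR hx ?_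
  have hmass : ∫ y, (Metric.closedBall (0 : EuclideanSpace ℝ (Fin d)) (1/2)).indicator
      (scaled d φ ε) y = ∫ y, (Metric.closedBall (0 : EuclideanSpace ℝ (Fin d)) (ε⁻¹ * (1/2))).indicator
      φ y := by
    have e : (Metric.closedBall (0 : EuclideanSpace ℝ (Fin d)) (1/2)).indicator
      (scaled d φ ε) = fun y => (ε ^ d)⁻¹ * (Metric.closedBall (0 : EuclideanSpace ℝ (Fin d))
        (ε⁻¹ * (1/2))).indicator φ (ε⁻¹ • y) := by
      funext y
      have hiff : ‖ε⁻¹ • y‖ ≤ ε⁻¹ * (1/2) ↔ ‖y‖ ≤ 1/2 := by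
        rw [norm_smul, Real.norm_of_nonneg (by positivity)]
        exact mul_le_mul_iff_right₀ (by positivity)
      by_cases hy : ‖y‖ ≤ 1/2
      · rw [Set.indicator_of_mem (by simpa using hy),
          Set.indicator_of_mem (by simpa only [mem_closedBall_zero_iff] using hiff.2 hy)]
        rfl
      · rw [Set.indicator_of_notMem (by simpa using hy),
          Set.indicator_of_notMem (by simpa only [mem_closedBall_zero_iff] using fun h => hy (hiff.1 h))]
        simp
    rw [e, integral_const_mul, Measure.integral_comp_inv_smul_of_nonneg _ _ hε0.le]
    simp only [finrank_euclideanSpace, Fintype.card_fin, smul_eq_mul]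
    rw [← mul_assoc, inv_mul_cancel₀ hεd.ne', one_mul]
  rw [hmass, integral_indicator measurableSet_closedBall]
  refine hn.le.trans (setIntegral_mono_set hi.integrableOn (Eventually.of_forall h0) ?_)
  refine (Metric.closedBall_subset_closedBall ?_).eventuallyLE
  have h3 : ε * (2 * (n + 1)) < 1 := by
    rwa [lt_div_iff₀ (by positivity)] at hε1
  rw [inv_mul_eq_div, le_div_iff₀ hε0]
  nlinarith

/-- Tail bound around a suitable center. -/
lemma aux_tail (d : ℕ) (K : EuclideanSpace ℝ (Fin d) → ℝ) (q C : ℝ) (hC : 0 < C)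
    (hq1 : 0 < q)
    (hK : ∀ R : ℝ, 1 ≤ R → ∀ x : EuclideanSpace ℝ (Fin d), 2 * R ≤ ‖x‖ → R ^ q / q / 4 ≤ K x)
    (μ : Measure (EuclideanSpace ℝ (Fin d))) [IsProbabilityMeasure μ]
    (hE : energyE d (fun x => ENNReal.ofReal (K x)) μ ≤ ENNReal.ofReal C) :
    ∃ y : EuclideanSpace ℝ (Fin d), ∀ R : ℝ, 1 ≤ R →
      (Measure.map (fun x => x - y) μ) {x | 2 * R < ‖x‖} ≤
        ENNReal.ofReal ((C + 1) * (4 * q) / R ^ q) := by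
  obtain ⟨y, hy⟩ : ∃ y, ∫⁻ x, ENNReal.ofReal (K (y - x)) ∂μ ≤ ENNReal.ofReal (C + 1) := by
    by_contra! h
    have h1 : ENNReal.ofReal (C + 1) ≤ ENNReal.ofReal C := by
      refine le_trans ?_ hE
      calc ENNReal.ofReal (C + 1) = ∫⁻ y, ENNReal.ofReal (C + 1) ∂μ := by simp
        _ ≤ _ := lintegral_mono fun y => (h y).le
    rw [ENNReal.ofReal_le_ofReal_iff hC.le] at h1
    linarith
  refine ⟨y, fun R hR => ?_⟩
  have hR0 : 0 < R := by linarith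
  have hms : MeasurableSet {x : EuclideanSpace ℝ (Fin d) | 2 * R < ‖x‖} :=
    measurableSet_lt measurable_const measurable_norm
  rw [Measure.map_apply (by fun_prop) hms]
  set S := (fun x => x - y) ⁻¹' {x : EuclideanSpace ℝ (Fin d) | 2 * R < ‖x‖} with hS
  have hSm : MeasurableSet S := hms.preimage (by fun_prop)
  have hc : 0 < R ^ q / q / 4 := by positivity
  have h1 : ENNReal.ofReal (R ^ q / q / 4) * μ S ≤ ENNReal.ofReal (C + 1) := by
    refine le_trans ?_ hy
    rw [← lintegral_indicator_const hSm]
    refine lintegral_mono fun x => ?_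
    by_cases hx : x ∈ S
    · rw [Set.indicator_of_mem hx]
      refine ENNReal.ofReal_le_ofReal (hK R hR _ ?_)
      have : 2 * R < ‖x - y‖ := hx
      rw [norm_sub_rev]
      exact this.le
    · rw [Set.indicator_of_notMem hx]; exact zero_le
  have h2 : (C + 1) * (4 * q) / R ^ q = (C + 1) / (R ^ q / q / 4) := by
    field_simp
  rw [h2, ENNReal.ofReal_div_of_pos hc, ENNReal.le_div_iff_mul_le (Or.inl (by simpa using hc))
    (Or.inl ENNReal.ofReal_ne_top), mul_comm]
  exact h1

/-- Compactness: sequences with uniformly bounded regularized energies,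
up to a subsequence and translations, converge weakly-*. -/
theorem compactness_bounded_regularized_energy
    (d : ℕ) (hd : 3 ≤ d) (p q : ℝ) (hp1 : 2 - (d : ℝ) ≤ p) (hp2 : p < 0)
    (hq1 : 0 < q) (hq2 : q ≤ 2)
    (φ : EuclideanSpace ℝ (Fin d) → ℝ) (hφ : IsMollifier d φ) :
    ∃ ε₀ : ℝ, 0 < ε₀ ∧ ∀ C : ℝ, 0 < C →
      ∀ ε : ℕ → ℝ, (∀ k, ε k ∈ Set.Ioo 0 ε₀) → Tendsto ε atTop (𝓝 0) →
      ∀ μ : ℕ → Measure (EuclideanSpace ℝ (Fin d)), (∀ k, IsProbabilityMeasure (μ k)) →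
        (∀ k, energyReg d p q φ (ε k) (μ k) ≤ ENNReal.ofReal C) →
        ∃ ks : ℕ → ℕ, StrictMono ks ∧
          ∃ y : ℕ → EuclideanSpace ℝ (Fin d),
            ∃ ν : Measure (EuclideanSpace ℝ (Fin d)), IsProbabilityMeasure ν ∧
              WeakStarTendsto d
                (fun j => Measure.map (fun x => x - y j) (μ (ks j))) ν := by
  obtain ⟨ε₀, hε₀, hK⟩ := aux_kreg d hd p q hp1 hp2 hq1 hq2 φ hφ
  refine ⟨ε₀, hε₀, ?_⟩
  intro C hC ε hε _ μ hμ hE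
  have hy := fun k => aux_tail d (Kreg d p q φ (ε k)) q C hC hq1 (hK (ε k) (hε k)) (μ k) (hE k)
  choose y hy using hy
  have hmap : ∀ k, IsProbabilityMeasure (Measure.map (fun x => x - y k) (μ k)) := fun k =>
    Measure.isProbabilityMeasure_map (by fun_prop)
  let P : ℕ → ProbabilityMeasure (EuclideanSpace ℝ (Fin d)) := fun k =>
    ⟨Measure.map (fun x => x - y k) (μ k), hmap k⟩
  have htight : IsTightMeasureSet
      {((m : ProbabilityMeasure (EuclideanSpace ℝ (Fin d))) : Measure (EuclideanSpace ℝ (Fin d))) | m ∈ Set.range P} := by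
    apply isTightMeasureSet_of_tendsto_measure_norm_gt
    have hlim : Tendsto (fun r : ℝ => ENNReal.ofReal ((C + 1) * (4 * q) / (r / 2) ^ q)) atTop (𝓝 0) := by
      rw [← ENNReal.ofReal_zero]
      apply ENNReal.tendsto_ofReal
      apply Tendsto.const_div_atTop
      exact (tendsto_rpow_atTop hq1).comp (tendsto_id.atTop_div_const (by norm_num))
    refine tendsto_of_tendsto_of_tendsto_of_le_of_le' tendsto_const_nhds hlim
      (Eventually.of_forall fun _ => zero_le) ?_
    filter_upwards [eventually_ge_atTop 2] with r hr
    refine iSup₂_le ?_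
    rintro _ ⟨_, ⟨k, rfl⟩, rfl⟩
    have := hy k (r / 2) (by linarith)
    rw [mul_div_cancel₀ r (by norm_num : (2:ℝ) ≠ 0)] at this
    exact this
  have hcomp := isCompact_closure_of_isTightMeasureSet htight
  obtain ⟨ν, -, ks, hks, hlim⟩ := hcomp.tendsto_subseq (x := P)
    (fun n => subset_closure (Set.mem_range_self n))
  refine ⟨ks, hks, fun j => y (ks j), ν, inferInstance, ?_⟩
  rintro f hf ⟨M, hM⟩
  rw [ProbabilityMeasure.tendsto_iff_forall_integral_tendsto] at hlim
  exact hlim (BoundedContinuousFunction.ofNormedAddCommGroup f hf M hM)
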